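/- The Laplace-type transform vanishes at infinity: Φ(n) → 0 as n → +∞, i.e., φ̃(ξ) → 0 as ‖ξ‖ → ∞. Moreover, Φ(n) = (1 − 1/p) ∑_{j ≤ −n} p^j ψ(j) − p^{-n} ψ(−n+1) for every n ∈ ℤ, and if ψ is constant then Φ(n) = 0 for all n ∈ ℤ. -/

import Mathlib

open MeasureTheory Complex

noncomputable section

variable (p : ℕ) [Fact p.Prime] [MeasurableSpace ℚ_[p]] [BorelSpace ℚ_[p]]

/-- The radial function `v_0`: equal to `1` for `‖z‖ ≤ 1`, to `−1/(p−1)` for `‖z‖ = p`,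
and to `0` for `‖z‖ ≥ p²`. -/
def v0 (z : ℚ_[p]) : ℂ :=
  if ‖z‖ ≤ 1 then 1
  else if ‖z‖ = (p : ℝ) then -1 / ((p : ℂ) - 1)
  else 0

/-- The Laplace-type transform `φ̃(ξ) = ∫_{ℚ_p} v_0(xξ) φ(x) dμ(x)`. -/
def laplace (μ : Measure ℚ_[p]) (φ : ℚ_[p] → ℂ) (ξ : ℚ_[p]) : ℂ :=
  ∫ x, v0 p (x * ξ) * φ x ∂μ

/-- `Φ(n)`: the value of the Laplace-type transform at any `ξ` with `‖ξ‖ = pⁿ`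
(here taken at `ξ = p^{-n}`, which has norm `pⁿ`). -/
def Phi (μ : Measure ℚ_[p]) (φ : ℚ_[p] → ℂ) (n : ℤ) : ℂ :=
  laplace p μ φ ((p : ℚ_[p]) ^ (-n))

set_option linter.unusedSectionVars false

theorem closedBall_zpow_succ_eq_iUnion (k : ℤ) :
    {x : ℚ_[p] | ‖x‖ ≤ (p : ℝ) ^ (k + 1)} =
      ⋃ a : Fin p, (fun x : ℚ_[p] => x + -((a : ℕ) * (p : ℚ_[p]) ^ (-(k + 1)))) ⁻¹'
        {x | ‖x‖ ≤ (p : ℝ) ^ k} := by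
  have hp : (p : ℚ_[p]) ≠ 0 := mod_cast (Fact.out : p.Prime).ne_zero
  have hpr : (0 : ℝ) < p := mod_cast (Fact.out : p.Prime).pos
  ext x
  simp only [Set.mem_ofPred_eq, Set.mem_iUnion, Set.mem_preimage]
  constructor
  · intro hx
    have hu : ‖x * (p : ℚ_[p]) ^ (k + 1)‖ ≤ 1 := by
      rw [norm_mul, Padic.norm_p_zpow, zpow_neg, ← div_eq_mul_inv]
      exact div_le_one_of_le₀ hx (by positivity)
    obtain ⟨u, hux⟩ : ∃ u : ℤ_[p], (u : ℚ_[p]) = x * (p : ℚ_[p]) ^ (k + 1) := ⟨⟨_, hu⟩, rfl⟩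
    have hmem := u.norm_sub_zmodRepr_lt_one
    refine ⟨⟨_, u.zmodRepr_lt_p⟩, ?_⟩
    rw [PadicInt.norm_def] at hmem
    push_cast at hmem ⊢
    generalize u.zmodRepr = a at hmem ⊢
    rw [hux] at hmem
    rw [Padic.norm_le_pow_iff_norm_lt_pow_add_one]
    have he : x + -((a : ℚ_[p]) * (p : ℚ_[p]) ^ (-(k + 1))) =
        (x * (p : ℚ_[p]) ^ (k + 1) - a) * (p : ℚ_[p]) ^ (-(k + 1)) := by
      rw [zpow_neg]
      field_simp
      ring
    rw [he, norm_mul, Padic.norm_p_zpow, neg_neg]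
    exact mul_lt_of_lt_one_left (by positivity) hmem
  · rintro ⟨a, ha⟩
    have hc : ‖((a : ℕ) : ℚ_[p]) * (p : ℚ_[p]) ^ (-(k + 1))‖ ≤ (p : ℝ) ^ (k + 1) := by
      rw [norm_mul, Padic.norm_p_zpow, neg_neg]
      exact mul_le_of_le_one_left (by positivity)
        (by exact_mod_cast Padic.norm_int_le_one (p := p) a)
    have := Padic.nonarchimedean (x + -(((a : ℕ) : ℚ_[p]) * (p : ℚ_[p]) ^ (-(k + 1))))
      (((a : ℕ) : ℚ_[p]) * (p : ℚ_[p]) ^ (-(k + 1)))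
    rw [neg_add_cancel_right] at this
    refine this.trans (max_le (ha.trans ?_) hc)
    exact zpow_le_zpow_right₀ (mod_cast (Fact.out : p.Prime).one_le) (by lia)

theorem pairwise_disjoint_cosets_closedBall_zpow (k : ℤ) :
    Pairwise (Function.onFun Disjoint fun a : Fin p =>
      (fun x : ℚ_[p] => x + -((a : ℕ) * (p : ℚ_[p]) ^ (-(k + 1)))) ⁻¹'
        {x | ‖x‖ ≤ (p : ℝ) ^ k}) := by
  have hpr : (0 : ℝ) < p := mod_cast (Fact.out : p.Prime).pos
  intro a b hab
  refine Set.disjoint_left.2 fun x hxa hxb => hab ?_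
  simp only [Set.mem_ofPred_eq, Set.mem_preimage] at hxa hxb
  have h := (Padic.nonarchimedean _ _).trans (max_le hxb ((norm_neg _).trans_le hxa))
  rw [Padic.norm_le_pow_iff_norm_lt_pow_add_one] at h
  have he : x + -((b : ℕ) * (p : ℚ_[p]) ^ (-(k + 1))) +
      -(x + -((a : ℕ) * (p : ℚ_[p]) ^ (-(k + 1)))) =
      (((a : ℕ) - (b : ℕ) : ℤ) : ℚ_[p]) * (p : ℚ_[p]) ^ (-(k + 1)) := by
    push_cast
    ring
  rw [he, norm_mul, Padic.norm_p_zpow, neg_neg, mul_lt_iff_lt_one_left (by positivity),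
    Padic.norm_intCast_lt_one_iff] at h
  have h0 := Int.eq_zero_of_abs_lt_dvd h (by rw [abs_lt]; omega)
  exact Fin.ext (by lia)

section AddHaar

variable (μ : Measure ℚ_[p]) [μ.IsAddHaarMeasure]

theorem measurableSet_norm_le (r : ℝ) : MeasurableSet {x : ℚ_[p] | ‖x‖ ≤ r} :=
  (isClosed_le continuous_norm continuous_const).measurableSet

theorem measurableSet_norm_eq (r : ℝ) : MeasurableSet {x : ℚ_[p] | ‖x‖ = r} :=
  (isClosed_eq continuous_norm continuous_const).measurableSet

theorem measure_norm_le_ne_top (r : ℝ) : μ {x : ℚ_[p] | ‖x‖ ≤ r} ≠ ⊤ := by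
  have : {x : ℚ_[p] | ‖x‖ ≤ r} = Metric.closedBall 0 r := by ext; simp
  rw [this]
  exact (isCompact_closedBall _ _).measure_lt_top.ne

theorem measureReal_norm_le_zpow_succ (k : ℤ) :
    μ.real {x : ℚ_[p] | ‖x‖ ≤ (p : ℝ) ^ (k + 1)} =
      p * μ.real {x : ℚ_[p] | ‖x‖ ≤ (p : ℝ) ^ k} := by
  rw [closedBall_zpow_succ_eq_iUnion, Measure.real, measure_iUnion
    (pairwise_disjoint_cosets_closedBall_zpow p k)
    fun a => measurable_add_const _ (measurableSet_norm_le p _)]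
  simp only [measure_preimage_add_right]
  simp [Measure.real]

theorem measureReal_norm_le_zpow (hμ : μ {x : ℚ_[p] | ‖x‖ ≤ 1} = 1) (k : ℤ) :
    μ.real {x : ℚ_[p] | ‖x‖ ≤ (p : ℝ) ^ k} = (p : ℝ) ^ k := by
  have hp : (p : ℝ) ≠ 0 := mod_cast (Fact.out : p.Prime).ne_zero
  induction k using Int.induction_on with
  | zero => simp [Measure.real, hμ]
  | succ k ih => rw [measureReal_norm_le_zpow_succ, ih, zpow_add_one₀ hp, mul_comm]
  | pred k ih =>
    have h := measureReal_norm_le_zpow_succ p μ (-(k : ℤ) - 1)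
    rw [sub_add_cancel, ih] at h
    exact mul_left_cancel₀ hp (h.symm.trans (by rw [zpow_sub_one₀ hp]; field_simp))

theorem measureReal_norm_eq_zpow (hμ : μ {x : ℚ_[p] | ‖x‖ ≤ 1} = 1) (k : ℤ) :
    μ.real {x : ℚ_[p] | ‖x‖ = (p : ℝ) ^ k} = (p : ℝ) ^ k * (1 - 1 / p) := by
  have hp : (p : ℝ) ≠ 0 := mod_cast (Fact.out : p.Prime).ne_zero
  have hset : {x : ℚ_[p] | ‖x‖ = (p : ℝ) ^ k} =
      {x : ℚ_[p] | ‖x‖ ≤ (p : ℝ) ^ k} \ {x : ℚ_[p] | ‖x‖ ≤ (p : ℝ) ^ (k - 1)} := by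
    ext x
    simp only [Set.mem_ofPred_eq, Set.mem_sdiff, ← Padic.norm_lt_pow_iff_norm_le_pow_sub_one,
      not_lt]
    exact le_antisymm_iff
  rw [hset, measureReal_sdiff _ (measurableSet_norm_le p _) (measure_norm_le_ne_top p μ _),
    measureReal_norm_le_zpow p μ hμ, measureReal_norm_le_zpow p μ hμ, zpow_sub_one₀ hp]
  · ring
  · have hle : (p : ℝ) ^ (k - 1) ≤ (p : ℝ) ^ k :=
      zpow_le_zpow_right₀ (mod_cast (Fact.out : p.Prime).one_le) (by lia)
    exact fun x hx => le_trans hx hle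

/-- The integral of a radial function supported in the ball of radius `p ^ K`, as a sum over
spheres. -/
theorem hasSum_integral_radial (hμ : μ {x : ℚ_[p] | ‖x‖ ≤ 1} = 1) {f : ℚ_[p] → ℂ} {g : ℤ → ℂ}
    (hfg : ∀ (x : ℚ_[p]) (k : ℤ), ‖x‖ = (p : ℝ) ^ k → f x = g k) {K : ℤ}
    (hg : ∀ k, K < k → g k = 0)
    (hsum : Summable fun i : ℕ => (p : ℝ) ^ (K - (i : ℤ)) * ‖g (K - (i : ℤ))‖) :
    HasSum (fun i : ℕ => (((p : ℝ) ^ (K - (i : ℤ)) * (1 - 1 / p) : ℝ) : ℂ) * g (K - (i : ℤ)))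
      (∫ x, f x ∂μ) := by
  have hp1 : (1 : ℝ) < p := mod_cast (Fact.out : p.Prime).one_lt
  have hinj := zpow_right_injective₀ (zero_lt_one.trans hp1) hp1.ne'
  set F : ℕ → ℚ_[p] → ℂ := fun i =>
    {x : ℚ_[p] | ‖x‖ = (p : ℝ) ^ (K - (i : ℤ))}.indicator fun _ => g (K - (i : ℤ)) with hF
  have hF_int : ∀ i, Integrable (F i) μ := fun i =>
    (integrableOn_const (measure_ne_top_of_subset (fun _ hx => le_of_eq hx)
      (measure_norm_le_ne_top p μ _))).integrable_indicator (measurableSet_norm_eq p _)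
  have hF_norm : ∀ i : ℕ, ∫ x, ‖F i x‖ ∂μ =
      (p : ℝ) ^ (K - (i : ℤ)) * ‖g (K - (i : ℤ))‖ * (1 - 1 / p) := by
    intro i
    simp only [hF, norm_indicator_eq_indicator_norm]
    rw [integral_indicator_const _ (measurableSet_norm_eq p _), measureReal_norm_eq_zpow p μ hμ,
      smul_eq_mul]
    ring
  have h := hasSum_integral_of_summable_integral_norm hF_int
    (by simpa only [hF_norm] using hsum.mul_right _)
  have hF_integral : ∀ i : ℕ, ∫ x, F i x ∂μ =
      (((p : ℝ) ^ (K - (i : ℤ)) * (1 - 1 / p) : ℝ) : ℂ) * g (K - (i : ℤ)) := by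
    intro i
    simp only [hF]
    rw [integral_indicator_const _ (measurableSet_norm_eq p _), measureReal_norm_eq_zpow p μ hμ,
      real_smul]
  have hf : ∫ x, f x ∂μ = ∫ x, ∑' i, F i x ∂μ := by
    refine integral_congr_ae ?_
    filter_upwards [compl_mem_ae_iff.2 (measure_singleton (μ := μ) (0 : ℚ_[p]))] with x hx
    have hx := Padic.norm_eq_zpow_neg_valuation hx
    set k := -x.valuation
    rw [hfg x k hx]
    rcases le_or_gt k K with hk | hk
    · rw [tsum_eq_single (K - k).toNat]
      · have : K - ((K - k).toNat : ℤ) = k := by lia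
        simp only [hF, this]
        exact (Set.indicator_of_mem (s := {x : ℚ_[p] | ‖x‖ = (p : ℝ) ^ k}) hx fun _ => g k).symm
      · intro i hi
        refine Set.indicator_of_notMem (fun hmem => hi ?_) _
        have := hinj (hx.symm.trans hmem)
        lia
    · rw [hg k hk, eq_comm]
      convert tsum_zero with i
      refine Set.indicator_of_notMem (fun hmem => ?_) _
      have := hinj (hx.symm.trans hmem)
      lia
  rw [hf]
  simpa only [hF_integral] using h

theorem v0_of_norm_eq_zpow {z : ℚ_[p]} {k : ℤ} (hz : ‖z‖ = (p : ℝ) ^ k) :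
    v0 p z = if k ≤ 0 then 1 else if k = 1 then -1 / ((p : ℂ) - 1) else 0 := by
  have hp1 : (1 : ℝ) < p := mod_cast (Fact.out : p.Prime).one_lt
  have hinj := zpow_right_injective₀ (zero_lt_one.trans hp1) hp1.ne'
  have h1 : (p : ℝ) ^ k = p ↔ k = 1 := by simpa using hinj.eq_iff (a := k) (b := 1)
  simp only [v0, hz, zpow_le_one_iff_right₀ hp1, h1]

theorem Phi_eq_tsum (hμ : μ {x : ℚ_[p] | ‖x‖ ≤ 1} = 1) {φ : ℚ_[p] → ℂ} {ψ : ℤ → ℂ}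
    (hψ : ∀ (x : ℚ_[p]) (k : ℤ), ‖x‖ = (p : ℝ) ^ k → φ x = ψ k) (n : ℤ)
    (hint : Summable fun i : ℕ => (p : ℝ) ^ (-n - (i : ℤ)) * ‖ψ (-n - (i : ℤ))‖) :
    Phi p μ φ n = (1 - 1 / (p : ℂ)) *
          ∑' i : ℕ, (((p : ℝ) ^ (-n - (i : ℤ)) : ℝ) : ℂ) * ψ (-n - (i : ℤ))
        - (((p : ℝ) ^ (-n) : ℝ) : ℂ) * ψ (-n + 1) := by
  have hp0 : (p : ℝ) ≠ 0 := mod_cast (Fact.out : p.Prime).ne_zero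
  have hpc : (p : ℂ) ≠ 0 := mod_cast (Fact.out : p.Prime).ne_zero
  have hpc1 : (p : ℂ) - 1 ≠ 0 := sub_ne_zero.2 (mod_cast (Fact.out : p.Prime).ne_one)
  set c : ℤ → ℂ := fun k => if k ≤ 0 then 1 else if k = 1 then -1 / ((p : ℂ) - 1) else 0 with hc
  have hfg : ∀ (x : ℚ_[p]) (k : ℤ), ‖x‖ = (p : ℝ) ^ k →
      v0 p (x * (p : ℚ_[p]) ^ (-n)) * φ x = c (k + n) * ψ k := by
    intro x k hx
    rw [hψ x k hx, v0_of_norm_eq_zpow p (k := k + n)]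
    rw [norm_mul, Padic.norm_p_zpow, neg_neg, hx, zpow_add₀ hp0]
  have hshift : ∀ i : ℕ, -n + 1 - ((i + 1 : ℕ) : ℤ) = -n - i := fun i => by lia
  have hcs : ∀ i : ℕ, c (-n - i + n) = 1 := fun i => if_pos (by lia)
  have hc0 : c (-n + 1 + n) = -1 / ((p : ℂ) - 1) := by simp [hc]
  have h := hasSum_integral_radial p μ hμ hfg (K := -n + 1)
    (fun k hk => by simp only [hc]; rw [if_neg (by lia), if_neg (by lia), zero_mul])
    ((summable_nat_add_iff (f := fun i : ℕ => (p : ℝ) ^ (-n + 1 - (i : ℤ)) *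
      ‖c (-n + 1 - i + n) * ψ (-n + 1 - i)‖) 1).1
      (by simpa only [hshift, hcs, one_mul] using hint))
  rw [Phi, laplace, ← h.tsum_eq, h.summable.tsum_eq_zero_add, ← tsum_mul_left]
  simp only [hshift, hcs, one_mul, Nat.cast_zero, sub_zero, hc0]
  rw [zpow_add_one₀ hp0, add_comm]
  refine (congrArg₂ (· + ·) (tsum_congr fun i => ?_) ?_).trans (sub_eq_add_neg _ _).symm
  · push_cast
    ring
  · push_cast
    field_simp

end AddHaar

theorem tsum_zpow_neg_sub_natCast {a : ℝ} (ha : 1 < a) (n : ℤ) :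
    ∑' i : ℕ, (((a : ℝ) ^ (-n - (i : ℤ)) : ℝ) : ℂ) = ((a ^ (-n) : ℝ) : ℂ) *
      (1 - 1 / (a : ℂ))⁻¹ := by
  have ha0 : a ≠ 0 := (zero_lt_one.trans ha).ne'
  rw [← ofReal_tsum]
  simp only [zpow_sub₀ ha0, zpow_natCast, div_eq_mul_inv, ← inv_pow]
  rw [tsum_mul_left, tsum_geometric_of_lt_one (by positivity) (inv_lt_one_of_one_lt₀ ha)]
  push_cast
  simp

/-- The Laplace-type transform vanishes at infinity: `Φ(n) → 0` as
`n → +∞`; moreover `Φ(n) = (1 − 1/p) ∑_{j ≤ −n} p^j ψ(j) − p^{-n} ψ(−n+1)` for all `n ∈ ℤ`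
(the sum over `j ≤ −n` being written as a sum over `i ≥ 0` with `j = −n − i`), and if `ψ`
is constant then `Φ ≡ 0`. -/
theorem statement19
    (μ : Measure ℚ_[p]) [μ.IsAddHaarMeasure]
    (hμ : μ {x : ℚ_[p] | ‖x‖ ≤ 1} = 1)
    (φ : ℚ_[p] → ℂ) (ψ : ℤ → ℂ)
    (hψ : ∀ (x : ℚ_[p]) (k : ℤ), ‖x‖ = (p : ℝ) ^ k → φ x = ψ k)
    (hint : ∀ K : ℤ, Summable (fun n : ℕ => (p : ℝ) ^ (K - (n : ℤ)) * ‖ψ (K - (n : ℤ))‖)) :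
    Filter.Tendsto (Phi p μ φ) Filter.atTop (nhds 0) ∧
    (∀ n : ℤ, Phi p μ φ n
      = (1 - 1 / (p : ℂ)) *
          ∑' i : ℕ, (((p : ℝ) ^ (-n - (i : ℤ)) : ℝ) : ℂ) * ψ (-n - (i : ℤ))
        - (((p : ℝ) ^ (-n) : ℝ) : ℂ) * ψ (-n + 1)) ∧
    ((∀ k l : ℤ, ψ k = ψ l) → ∀ n : ℤ, Phi p μ φ n = 0) := by
  have hΦ := fun n : ℤ => Phi_eq_tsum p μ hμ hψ n (hint (-n))
  have hp1 : (1 : ℝ) < p := mod_cast (Fact.out : p.Prime).one_lt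
  have hp0 : (p : ℝ) ≠ 0 := (zero_lt_one.trans hp1).ne'
  refine ⟨?_, hΦ, fun hconst n => ?_⟩
  · set g : ℕ → ℂ := fun i => (((p : ℝ) ^ (1 - (i : ℤ)) : ℝ) : ℂ) * ψ (1 - (i : ℤ)) with hg
    have hgs : Summable g := by
      refine Summable.of_norm ((hint 1).congr fun i => ?_)
      rw [hg, norm_mul, norm_real, Real.norm_of_nonneg (by positivity)]
    have htail := (tendsto_sum_nat_add g).comp (Filter.tendsto_add_atTop_nat 1)
    have hlim := (htail.const_mul (1 - 1 / (p : ℂ))).sub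
      (hgs.tendsto_atTop_zero.const_mul (1 / (p : ℂ)))
    rw [← Nat.map_cast_int_atTop, Filter.tendsto_map'_iff]
    simp only [mul_zero, sub_zero] at hlim
    refine hlim.congr fun N => ?_
    have hN : (1 : ℤ) - N = -N + 1 := by ring
    have hi : ∀ i : ℕ, (1 : ℤ) - ((i + (N + 1) : ℕ) : ℤ) = -N - i := fun i => by lia
    simp only [Function.comp_apply, hΦ, hg, hi, hN]
    rw [zpow_add_one₀ hp0]
    push_cast
    have hpc : (p : ℂ) ≠ 0 := mod_cast hp0
    field_simp
  · have hpc : 1 - 1 / (p : ℂ) ≠ 0 := by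
      rw [sub_ne_zero, ne_comm, one_div, ne_eq, inv_eq_one]
      exact mod_cast hp1.ne'
    have hψ0 : ∀ k, ψ k = ψ 0 := fun k => hconst k 0
    rw [hΦ]
    simp only [hψ0, tsum_mul_right]
    rw [tsum_zpow_neg_sub_natCast hp1, ofReal_natCast]
    field_simp
    ring
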